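/- Let l, l1, l2 be lightlike vectors in the closed forward light cone V̄+ such that {l, l1} and {l, l2} are each linearly independent. Then the topological closure of W[l,l1] ∩ W[l,l2] equals the intersection of the closures of W[l,l1] and of W[l,l2]. -/

import Mathlib

noncomputable section

/-- Minkowski spacetime: ℝ⁴. -/
abbrev M4 : Type := Fin 4 → ℝ

/-- Minkowski bilinear form. -/
def mink (x y : M4) : ℝ := x 0 * y 0 - x 1 * y 1 - x 2 * y 2 - x 3 * y 3

/-- Lightlike vector. -/
def Lightlike (l : M4) : Prop := l ≠ 0 ∧ mink l l = 0

/-- Closed forward light cone. -/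
def closedForwardCone : Set M4 := {x | 0 ≤ mink x x ∧ 0 ≤ x 0}

/-- Open forward light cone. -/
def openForwardCone : Set M4 := {x | 0 < mink x x ∧ 0 < x 0}

/-- The wedge W[l₁,l₂]. -/
def wedge (l1 l2 : M4) : Set M4 :=
  {x | ∃ (α β : ℝ) (p : M4), 0 < α ∧ β < 0 ∧ mink p l1 = 0 ∧ mink p l2 = 0 ∧
      x = α • l1 + β • l2 + p}

/-- Spacelike complement of a set. -/
def scomp (S : Set M4) : Set M4 := {x | ∀ s ∈ S, mink (x - s) (x - s) < 0}

/-- Causal complement: the interior of the spacelike complement. -/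
def ccomp (S : Set M4) : Set M4 := interior (scomp S)

lemma mink_add_left (x y z : M4) : mink (x + y) z = mink x z + mink y z := by
  simp only [mink, Pi.add_apply]; ring

lemma mink_smul_left (a : ℝ) (x z : M4) : mink (a • x) z = a * mink x z := by
  simp only [mink, Pi.smul_apply, smul_eq_mul]; ring

lemma mink_comm (x y : M4) : mink x y = mink y x := by
  simp only [mink]; ring

lemma continuous_mink_left (z : M4) : Continuous fun x : M4 => mink x z := by
  unfold mink; fun_prop

lemma Lightlike.time_pos {l : M4} (hl : Lightlike l) (hc : l ∈ closedForwardCone) :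
    0 < l 0 := by
  refine lt_of_le_of_ne hc.2 fun h0 => hl.1 ?_
  have h := hl.2
  simp only [mink, ← h0] at h
  ext i
  fin_cases i
  · exact h0.symm
  all_goals
    simp only [Fin.reduceFinMk, Fin.mk_one, Pi.zero_apply]
    nlinarith [sq_nonneg (l 1), sq_nonneg (l 2), sq_nonneg (l 3)]

/-- Linearly independent forward lightlike vectors have positive Minkowski product. -/
lemma Lightlike.mink_pos {l m : M4} (hl : Lightlike l) (hm : Lightlike m)
    (hcl : l ∈ closedForwardCone) (hcm : m ∈ closedForwardCone)
    (hli : LinearIndependent ℝ ![l, m]) : 0 < mink l m := by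
  have hl0 := hl.time_pos hcl
  have hm0 := hm.time_pos hcm
  by_contra! hle
  have key : (m 0 * l 1 - l 0 * m 1) ^ 2 + (m 0 * l 2 - l 0 * m 2) ^ 2
      + (m 0 * l 3 - l 0 * m 3) ^ 2 = 2 * (l 0 * m 0) * mink l m := by
    have hll := hl.2
    have hmm := hm.2
    simp only [mink] at hll hmm ⊢
    linear_combination -(m 0) ^ 2 * hll - (l 0) ^ 2 * hmm
  have hnonpos : 2 * (l 0 * m 0) * mink l m ≤ 0 :=
    mul_nonpos_of_nonneg_of_nonpos (by positivity) hle
  have hdep : m 0 • l + (-l 0) • m = 0 := by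
    ext i
    simp only [Pi.add_apply, Pi.smul_apply, smul_eq_mul, Pi.zero_apply]
    have e1 := sq_nonneg (m 0 * l 1 - l 0 * m 1)
    have e2 := sq_nonneg (m 0 * l 2 - l 0 * m 2)
    have e3 := sq_nonneg (m 0 * l 3 - l 0 * m 3)
    fin_cases i
    · simp only [Fin.zero_eta]; ring
    · have h : m 0 * l 1 - l 0 * m 1 = 0 := pow_eq_zero_iff two_ne_zero |>.1 (by linarith)
      simp only [Fin.mk_one]; linarith
    · have h : m 0 * l 2 - l 0 * m 2 = 0 := pow_eq_zero_iff two_ne_zero |>.1 (by linarith)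
      simp only [Fin.reduceFinMk]; linarith
    · have h : m 0 * l 3 - l 0 * m 3 = 0 := pow_eq_zero_iff two_ne_zero |>.1 (by linarith)
      simp only [Fin.reduceFinMk]; linarith
  exact hm0.ne' (LinearIndependent.pair_iff.1 hli _ _ hdep).1

/-- A wedge is the intersection of two open half-spaces with lightlike normals. -/
lemma mem_wedge_iff {l m : M4} (hl : mink l l = 0) (hm : mink m m = 0) (hpos : 0 < mink l m)
    (x : M4) : x ∈ wedge l m ↔ mink x l < 0 ∧ 0 < mink x m := by
  have hml : mink m l = mink l m := mink_comm m l
  constructor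
  · rintro ⟨α, β, p, hα, hβ, hpl, hpm, rfl⟩
    simp only [mink_add_left, mink_smul_left, hl, hm, hpl, hpm, hml]
    constructor
    · nlinarith [mul_neg_of_neg_of_pos hβ hpos]
    · nlinarith [mul_pos hα hpos]
  · rintro ⟨hxl, hxm⟩
    refine ⟨mink x m / mink l m, mink x l / mink l m,
      x + (-(mink x m / mink l m)) • l + (-(mink x l / mink l m)) • m,
      div_pos hxm hpos, div_neg_of_neg_of_pos hxl hpos, ?_, ?_, ?_⟩
    · simp only [mink_add_left, mink_smul_left, hl, hml]
      field_simp
      ring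
    · simp only [mink_add_left, mink_smul_left, hm]
      field_simp
      ring
    · module

lemma closure_wedge_subset {l m : M4} (hl : mink l l = 0) (hm : mink m m = 0)
    (hpos : 0 < mink l m) : closure (wedge l m) ⊆ {x | mink x l ≤ 0 ∧ 0 ≤ mink x m} := by
  refine closure_minimal (fun x hx => ?_) ?_
  · obtain ⟨h, h'⟩ := (mem_wedge_iff hl hm hpos x).1 hx
    exact ⟨h.le, h'.le⟩
  · exact (isClosed_le (continuous_mink_left l) continuous_const).inter
      (isClosed_le continuous_const (continuous_mink_left m))

theorem closure_wedge_inter (l l1 l2 : M4)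
    (hl : Lightlike l) (h1 : Lightlike l1) (h2 : Lightlike l2)
    (hcl : l ∈ closedForwardCone) (hc1 : l1 ∈ closedForwardCone)
    (hc2 : l2 ∈ closedForwardCone)
    (hli1 : LinearIndependent ℝ ![l, l1]) (hli2 : LinearIndependent ℝ ![l, l2]) :
    closure (wedge l l1 ∩ wedge l l2) = closure (wedge l l1) ∩ closure (wedge l l2) := by
  have p1 := hl.mink_pos h1 hcl hc1 hli1
  have p2 := hl.mink_pos h2 hcl hc2 hli2
  refine (closure_inter_subset_inter_closure _ _).antisymm ?_
  rintro x ⟨hx1, hx2⟩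
  obtain ⟨hxl, hxl1⟩ := closure_wedge_subset hl.2 h1.2 p1 hx1
  obtain ⟨-, hxl2⟩ := closure_wedge_subset hl.2 h2.2 p2 hx2
  obtain ⟨e, hel, he1, he2⟩ : ∃ e : M4, mink e l < 0 ∧ 0 < mink e l1 ∧ 0 < mink e l2 := by
    obtain ⟨a, ha1, ha2⟩ : ∃ a : ℝ, mink l2 l1 / mink l l1 < a ∧ mink l1 l2 / mink l l2 < a :=
      ⟨max (mink l2 l1 / mink l l1) (mink l1 l2 / mink l l2) + 1,
        (le_max_left _ _).trans_lt (lt_add_one _), (le_max_right _ _).trans_lt (lt_add_one _)⟩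
    rw [div_lt_iff₀ p1] at ha1
    rw [div_lt_iff₀ p2] at ha2
    refine ⟨a • l + (-1 : ℝ) • l1 + (-1 : ℝ) • l2, ?_, ?_, ?_⟩ <;>
      simp only [mink_add_left, mink_smul_left, hl.2, h1.2, h2.2]
    · rw [mink_comm l1 l, mink_comm l2 l]
      linarith
    · linarith
    · linarith
  have hcont : Continuous fun t : ℝ => x + t • e := by fun_prop
  have hlim : Filter.Tendsto (fun t : ℝ => x + t • e) (nhdsWithin 0 (Set.Ioi 0)) (nhds x) :=
    (by simpa using hcont.tendsto 0 :
      Filter.Tendsto (fun t : ℝ => x + t • e) (nhds 0) (nhds x)).mono_left nhdsWithin_le_nhds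
  refine mem_closure_of_tendsto hlim ?_
  filter_upwards [self_mem_nhdsWithin] with t ht
  rw [Set.mem_Ioi] at ht
  rw [Set.mem_inter_iff, mem_wedge_iff hl.2 h1.2 p1, mem_wedge_iff hl.2 h2.2 p2]
  simp only [mink_add_left, mink_smul_left]
  have hl' := mul_neg_of_pos_of_neg ht hel
  have h1' := mul_pos ht he1
  have h2' := mul_pos ht he2
  exact ⟨⟨by linarith, by linarith⟩, by linarith, by linarith⟩
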